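/- A 4×4 complex matrix M is of the form M = M(z) for some z ∈ ℂ³ with ‖z‖ = 1 if and only if M is skew-symmetric (Mᵀ = −M), M is special unitary (conj(M)ᵀ·M = I and det M = 1), and its Pfaffian equals 1, i.e. M₁₂M₃₄ − M₁₃M₂₄ + M₁₄M₂₃ = 1. -/

import Mathlib

open Matrix

/-- The skew-symmetric matrix `M(z)`, `z ∈ ℂ³`, representing Clifford multiplication. -/
noncomputable def Mz (z : Fin 3 → ℂ) : Matrix (Fin 4) (Fin 4) ℂ :=
  !![0, -z 2, -z 1, -z 0;
     z 2, 0, -(starRingEnd ℂ) (z 0), (starRingEnd ℂ) (z 1);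
     z 1, (starRingEnd ℂ) (z 0), 0, -(starRingEnd ℂ) (z 2);
     z 0, -(starRingEnd ℂ) (z 1), (starRingEnd ℂ) (z 2), 0]

/-- The Pfaffian of a `4 × 4` matrix, computed from its entries above the diagonal. -/
def pfaffianFour {R : Type*} [CommRing R] (M : Matrix (Fin 4) (Fin 4) R) : R :=
  M 0 1 * M 2 3 - M 0 2 * M 1 3 + M 0 3 * M 1 2

/-- The Pfaffian adjugate of a `4 × 4` skew-symmetric matrix. -/
def pfaffianAdjugate {R : Type*} [CommRing R] (M : Matrix (Fin 4) (Fin 4) R) :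
    Matrix (Fin 4) (Fin 4) R :=
  !![0, -M 2 3, M 1 3, -M 1 2;
     M 2 3, 0, -M 0 3, M 0 2;
     -M 1 3, M 0 3, 0, -M 0 1;
     M 1 2, -M 0 2, M 0 1, 0]

/-- A skew-symmetric complex matrix is determined by its entries above the diagonal. -/
lemma eq_of_transpose_eq_neg {M : Matrix (Fin 4) (Fin 4) ℂ} (h : Mᵀ = -M) :
    M = !![0, M 0 1, M 0 2, M 0 3;
           -M 0 1, 0, M 1 2, M 1 3;
           -M 0 2, -M 1 2, 0, M 2 3;
           -M 0 3, -M 1 3, -M 2 3, 0] := by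
  have hswap (i j : Fin 4) : M j i = -M i j := congrFun (congrFun h i) j
  have hdiag (i : Fin 4) : M i i = 0 := self_eq_neg.mp (hswap i i)
  ext i j
  fin_cases i <;> fin_cases j <;> simp [hdiag] <;> exact hswap _ _

lemma mul_pfaffianAdjugate {M : Matrix (Fin 4) (Fin 4) ℂ} (h : Mᵀ = -M) :
    M * pfaffianAdjugate M = pfaffianFour M • (1 : Matrix (Fin 4) (Fin 4) ℂ) := by
  rw [eq_of_transpose_eq_neg h]
  ext i j
  fin_cases i <;> fin_cases j <;>
    simp [pfaffianAdjugate, pfaffianFour, Matrix.mul_apply, Fin.sum_univ_four] <;> ring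

lemma det_eq_pfaffianFour_sq {M : Matrix (Fin 4) (Fin 4) ℂ} (h : Mᵀ = -M) :
    M.det = pfaffianFour M ^ 2 := by
  rw [eq_of_transpose_eq_neg h]
  simp [pfaffianFour, Matrix.det_succ_row_zero, Fin.sum_univ_succ, Fin.succAbove]
  ring

lemma transpose_Mz (z : Fin 3 → ℂ) : (Mz z)ᵀ = -Mz z := by
  ext i j
  fin_cases i <;> fin_cases j <;> simp [Mz]

lemma pfaffianFour_Mz (z : Fin 3 → ℂ) :
    pfaffianFour (Mz z) = ((∑ i, Complex.normSq (z i) : ℝ) : ℂ) := by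
  simp [pfaffianFour, Mz, Fin.sum_univ_three, ← Complex.mul_conj]
  ring

lemma conjTranspose_Mz (z : Fin 3 → ℂ) :
    ((Mz z).map (starRingEnd ℂ))ᵀ = pfaffianAdjugate (Mz z) := by
  ext i j
  fin_cases i <;> fin_cases j <;> simp [Mz, pfaffianAdjugate]

lemma eq_Mz_of_conjTranspose_eq {M : Matrix (Fin 4) (Fin 4) ℂ} (h : Mᵀ = -M)
    (hM : (M.map (starRingEnd ℂ))ᵀ = pfaffianAdjugate M) :
    M = Mz ![-M 0 3, -M 0 2, -M 0 1] := by
  have hswap (i j : Fin 4) : M j i = -M i j := congrFun (congrFun h i) j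
  have hentry (i j : Fin 4) : starRingEnd ℂ (M j i) = pfaffianAdjugate M i j :=
    congrFun (congrFun hM i) j
  have h12 : M 1 2 = starRingEnd ℂ (M 0 3) := by
    simpa [pfaffianAdjugate] using (hentry 3 0).symm
  have h13 : M 1 3 = -starRingEnd ℂ (M 0 2) := by
    simpa [pfaffianAdjugate, neg_eq_iff_eq_neg] using (hentry 2 0).symm
  have h23 : M 2 3 = starRingEnd ℂ (M 0 1) := by
    simpa [pfaffianAdjugate] using (hentry 1 0).symm
  refine (eq_of_transpose_eq_neg h).trans ?_
  rw [h12, h13, h23]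
  ext i j
  fin_cases i <;> fin_cases j <;> simp [Mz]

/-- `M = M(z)` for some unit vector `z ∈ ℂ³` iff `M` is skew-symmetric, special unitary,
and has Pfaffian `1`. -/
theorem Mz_characterization (M : Matrix (Fin 4) (Fin 4) ℂ) :
    (∃ z : Fin 3 → ℂ, (∑ i, Complex.normSq (z i)) = 1 ∧ M = Mz z)
      ↔ (Mᵀ = -M ∧ (M.map (starRingEnd ℂ))ᵀ * M = 1 ∧ M.det = 1 ∧
          M 0 1 * M 2 3 - M 0 2 * M 1 3 + M 0 3 * M 1 2 = 1) := by
  constructor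
  · rintro ⟨z, hz, rfl⟩
    have hskew := transpose_Mz z
    have hpf : pfaffianFour (Mz z) = 1 := by rw [pfaffianFour_Mz, hz, Complex.ofReal_one]
    refine ⟨hskew, ?_, ?_, hpf⟩
    · rw [conjTranspose_Mz, mul_eq_one_comm, mul_pfaffianAdjugate hskew, hpf, one_smul]
    · rw [det_eq_pfaffianFour_sq hskew, hpf, one_pow]
  · rintro ⟨hskew, hunitary, -, hpf⟩
    change pfaffianFour M = 1 at hpf
    have hinv : M * pfaffianAdjugate M = 1 := by
      rw [mul_pfaffianAdjugate hskew, hpf, one_smul]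
    have hM := eq_Mz_of_conjTranspose_eq hskew (left_inv_eq_right_inv hunitary hinv)
    refine ⟨_, ?_, hM⟩
    rw [hM, pfaffianFour_Mz] at hpf
    exact_mod_cast hpf
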